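/- arXiv:2404.10624 — 2 statements merged into one kernel-verified Lean document; each statement's English description precedes it below -/
import Mathlib

section
/- For every natural number k and every real number x, the k-th Hermite function satisfies |h_k(x)| ≤ π^{-1/4}. -/
open Real MeasureTheory

/-- The `k`-th physicists' Hermite polynomial (as a function):
`H_k(x) = (-1)^k e^{x²} (d^k/dx^k) e^{-x²}`. -/
noncomputable def hermitePoly (k : ℕ) (x : ℝ) : ℝ :=
  (-1 : ℝ) ^ k * Real.exp (x ^ 2) * iteratedDeriv k (fun y : ℝ => Real.exp (-y ^ 2)) x

/-- The `k`-th Hermite function `h_k(x) = (2^k k! √π)^{-1/2} H_k(x) e^{-x²/2}`. -/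
noncomputable def hermiteFun (k : ℕ) (x : ℝ) : ℝ :=
  (Real.sqrt (2 ^ k * (Nat.factorial k) * Real.sqrt π))⁻¹ * hermitePoly k x *
    Real.exp (-x ^ 2 / 2)

open Filter Topology Set

section HarmonicOscillator

/-! Solutions `u` of `u'' = -(A - x²) u` on `[0, ∞)`, with `v = u'`. -/

variable {A : ℝ} {u v : ℝ → ℝ}

lemma antitoneOn_oscillator_energy (hu : ∀ x, HasDerivAt u (v x) x)
    (hv : ∀ x, HasDerivAt v (-(A - x ^ 2) * u x) x) :
    AntitoneOn (fun x => v x ^ 2 + (A - x ^ 2) * u x ^ 2) (Ici 0) := by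
  have hd : ∀ x, HasDerivAt (fun x => v x ^ 2 + (A - x ^ 2) * u x ^ 2)
      (-(2 * x * u x ^ 2)) x := fun x => by
    refine HasDerivAt.congr_deriv
      (((hv x).fun_pow 2).fun_add
        ((((hasDerivAt_id' x).fun_pow 2).const_sub A).fun_mul ((hu x).fun_pow 2))) ?_
    simp
    ring
  refine antitoneOn_of_hasDerivWithinAt_nonpos (convex_Ici 0)
    (fun x _ => (hd x).continuousAt.continuousWithinAt) (fun x _ => (hd x).hasDerivWithinAt) ?_
  intro x hx
  rw [interior_Ici, mem_Ioi] at hx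
  have : 0 ≤ 2 * x * u x ^ 2 := by positivity
  linarith

lemma oscillator_energy_nonneg (hu : ∀ x, HasDerivAt u (v x) x)
    (hv : ∀ x, HasDerivAt v (-(A - x ^ 2) * u x) x)
    (hu0 : Tendsto u atTop (𝓝 0)) (hxu0 : Tendsto (fun x => x * u x) atTop (𝓝 0))
    (hv0 : Tendsto v atTop (𝓝 0)) {x : ℝ} (hx : 0 ≤ x) :
    0 ≤ v x ^ 2 + (A - x ^ 2) * u x ^ 2 := by
  have hlim : Tendsto (fun x => v x ^ 2 + (A - x ^ 2) * u x ^ 2) atTop (𝓝 0) := by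
    have h := ((hv0.pow 2).add ((hu0.pow 2).const_mul A)).sub (hxu0.pow 2)
    convert h using 2 <;> ring
  refine le_of_tendsto hlim ?_
  filter_upwards [eventually_ge_atTop x] with y hy
  exact antitoneOn_oscillator_energy hu hv hx (hx.trans hy) hy

/-- Sonin-type bound after the Liouville–Green transformation. -/
lemma sqrt_mul_sq_le_of_oscillator (hu : ∀ x, HasDerivAt u (v x) x)
    (hv : ∀ x, HasDerivAt v (-(A - x ^ 2) * u x) x) {x : ℝ} (hx : 0 ≤ x) (hxA : x ^ 2 < A) :
    √(A - x ^ 2) * u x ^ 2 ≤ √A * u 0 ^ 2 + v 0 ^ 2 / √A := by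
  have hA : 0 < A := (sq_nonneg x).trans_lt hxA
  set Q : ℝ → ℝ := fun y => A - y ^ 2 with hQ
  set p : ℝ → ℝ := fun y => v y - y * u y / (2 * Q y) with hp
  set R : ℝ → ℝ := fun y => 1 + (3 * y ^ 2 + 2 * A) / (4 * Q y ^ 3) with hR
  set S : ℝ → ℝ := fun y => √(Q y) * u y ^ 2 + p y ^ 2 / √(Q y) / R y with hS
  have hQpos : ∀ y ∈ Icc 0 x, 0 < Q y := fun y hy => by
    have := pow_le_pow_left₀ hy.1 hy.2 2
    simp only [hQ]; linarith
  have hRpos : ∀ y ∈ Icc 0 x, 0 < R y := fun y hy => by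
    have := hQpos y hy
    simp only [hR]; positivity
  have hdQ : ∀ y, HasDerivAt Q (-(2 * y)) y := fun y => by
    refine HasDerivAt.congr_deriv
      (((hasDerivAt_id' y).fun_pow 2).const_sub A) ?_
    simp
  have hdS : ∀ y ∈ Icc 0 x, HasDerivAt S
      (p y ^ 2 / √(Q y) * (-(6 * y / (4 * Q y ^ 3) +
        (3 * y ^ 2 + 2 * A) * (6 * y) / (4 * Q y ^ 4)) / R y ^ 2)) y := fun y hy => by
    have hq := hQpos y hy
    have hr := hRpos y hy
    have hs : 0 < √(Q y) := Real.sqrt_pos.2 hq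
    have hss : √(Q y) ^ 2 = Q y := Real.sq_sqrt hq.le
    have hdp : HasDerivAt p (-(y / (2 * Q y)) * p y - Q y * R y * u y) y := by
      refine HasDerivAt.congr_deriv
        ((hv y).fun_sub (((hasDerivAt_id' y).fun_mul (hu y)).fun_div ((hdQ y).const_mul 2)
        (by positivity))) ?_
      simp only [hp, hR]
      have : A = Q y + y ^ 2 := by simp [hQ]
      have h2 : A - y ^ 2 = Q y := rfl
      rw [h2, this]
      field_simp
      ring
    have hdR : HasDerivAt R (6 * y / (4 * Q y ^ 3) +
        (3 * y ^ 2 + 2 * A) * (6 * y) / (4 * Q y ^ 4)) y := by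
      refine HasDerivAt.congr_deriv
        (((((((hasDerivAt_id' y).fun_pow 2).const_mul 3).add_const (2 * A)).div
        (((hdQ y).fun_pow 3).const_mul 4) (by positivity)).const_add 1)) ?_
      simp
      field_simp
      ring
    have hds := (hdQ y).sqrt hq.ne'
    have h1 : HasDerivAt (fun y => √(Q y) * u y ^ 2) (2 * √(Q y) * u y * p y) y := by
      refine HasDerivAt.congr_deriv
        (hds.mul ((hu y).fun_pow 2)) ?_
      simp only [hp, Nat.cast_ofNat]
      rw [← hss]
      simp only [Real.sqrt_sq hs.le]
      field_simp
      simp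
      ring
    have h2 : HasDerivAt (fun y => p y ^ 2 / √(Q y)) (-(2 * √(Q y) * R y * u y * p y)) y := by
      refine HasDerivAt.congr_deriv
        ((hdp.pow 2).fun_div hds hs.ne') ?_
      rw [← hss]
      simp only [Real.sqrt_sq hs.le, Nat.cast_ofNat]
      field_simp
      simp
      ring
    refine HasDerivAt.congr_deriv
      (h1.add (h2.div hdR hr.ne')) ?_
    field_simp
    ring
  have hanti : AntitoneOn S (Icc 0 x) := by
    refine antitoneOn_of_hasDerivWithinAt_nonpos (convex_Icc 0 x)
      (fun y hy => (hdS y hy).continuousAt.continuousWithinAt)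
      (fun y hy => (hdS y (interior_subset hy)).hasDerivWithinAt) fun y hy => ?_
    have hy' := interior_subset hy
    have hy0 : 0 ≤ y := hy'.1
    have := hQpos y hy'
    refine mul_nonpos_of_nonneg_of_nonpos (by positivity)
      (div_nonpos_of_nonpos_of_nonneg (neg_nonpos.2 (by positivity)) (by positivity))
  have hSx := hanti (left_mem_Icc.2 hx) (right_mem_Icc.2 hx) hx
  have hqx := hRpos x (right_mem_Icc.2 hx)
  calc √(A - x ^ 2) * u x ^ 2 ≤ S x := by
        have : 0 ≤ p x ^ 2 / √(Q x) / R x := by positivity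
        simp only [hS, hQ] at this ⊢
        linarith
    _ ≤ S 0 := hSx
    _ ≤ √A * u 0 ^ 2 + v 0 ^ 2 / √A := by
        have hR0 : 1 ≤ R 0 := by
          simp only [hR, hQ]
          norm_num
          positivity
        have h := div_le_self (show 0 ≤ v 0 ^ 2 / √A by positivity) hR0
        simpa [hS, hp, hQ] using h

/-- A positive maximum of `u ^ 2` on `[0, ∞)` cannot be attained near or beyond the turning
point `√A`. -/
lemma le_sub_sq_of_isMaxOn_oscillator (hA : 3 ≤ A) (hu : ∀ x, HasDerivAt u (v x) x)
    (hv : ∀ x, HasDerivAt v (-(A - x ^ 2) * u x) x)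
    (hE : ∀ x, 0 ≤ x → 0 ≤ v x ^ 2 + (A - x ^ 2) * u x ^ 2)
    {a : ℝ} (ha : 0 ≤ a) (hva : v a = 0) (hpos : 0 < u a)
    (hmax : ∀ x, 0 ≤ x → |u x| ≤ u a) : 4 / 3 ≤ A - a ^ 2 := by
  by_contra! hlt
  set b := √(A + 1 / 2) with hb
  have hb2 : b ^ 2 = A + 1 / 2 := Real.sq_sqrt (by linarith)
  have hδ : 0 ≤ A - a ^ 2 := by
    have := hE a ha
    rw [hva] at this
    by_contra! h
    nlinarith [mul_pos (neg_pos.2 h) (pow_pos hpos 2)]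
  have ha0 : 0 < a := by
    rcases ha.eq_or_lt with h | h
    · rw [← h] at hlt; linarith
    · exact h
  have hab : a ≤ b := Real.le_sqrt_of_sq_le (by linarith)
  have hsq : ∀ x ∈ Icc a b, a ^ 2 ≤ x ^ 2 ∧ x ^ 2 ≤ A + 1 / 2 := fun x hx =>
    ⟨pow_le_pow_left₀ ha hx.1 2, hb2 ▸ pow_le_pow_left₀ (ha.trans hx.1) hx.2 2⟩
  have hvlow : ∀ x ∈ Icc a b, -(4 / 3 * u a * (x - a)) ≤ v x := by
    have hd : ∀ x, HasDerivAt (fun x => v x + 4 / 3 * u a * (x - a))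
        (-(A - x ^ 2) * u x + 4 / 3 * u a) x := fun x => by
      refine HasDerivAt.congr_deriv
        ((hv x).fun_add (((hasDerivAt_id' x).sub_const a).const_mul (4 / 3 * u a))) ?_
      ring
    have hmono : MonotoneOn (fun x => v x + 4 / 3 * u a * (x - a)) (Icc a b) := by
      refine monotoneOn_of_hasDerivWithinAt_nonneg (convex_Icc a b)
        (fun x _ => (hd x).continuousAt.continuousWithinAt)
        (fun x _ => (hd x).hasDerivWithinAt) fun x hx => ?_
      have hx' := interior_subset hx
      obtain ⟨h1, h2⟩ := hsq x hx'
      have h3 : |(A - x ^ 2) * u x| ≤ 4 / 3 * u a := by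
        rw [abs_mul]
        exact mul_le_mul (abs_le.2 ⟨by linarith, by linarith⟩) (hmax x (ha.trans hx'.1))
          (abs_nonneg _) (by norm_num)
      linarith [(abs_le.1 h3).2]
    intro x hx
    have := hmono (left_mem_Icc.2 hab) hx hx.1
    simp only [hva, sub_self, mul_zero, add_zero] at this
    linarith
  have hulow : ∀ x ∈ Icc a b, u a * (1 - 2 / 3 * (x - a) ^ 2) ≤ u x := by
    have hd : ∀ x, HasDerivAt (fun x => u x + 2 / 3 * u a * (x - a) ^ 2)
        (v x + 4 / 3 * u a * (x - a)) x := fun x => by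
      refine HasDerivAt.congr_deriv
        ((hu x).fun_add ((((hasDerivAt_id' x).sub_const a).fun_pow 2).const_mul (2 / 3 * u a))) ?_
      simp
      ring
    have hmono : MonotoneOn (fun x => u x + 2 / 3 * u a * (x - a) ^ 2) (Icc a b) := by
      refine monotoneOn_of_hasDerivWithinAt_nonneg (convex_Icc a b)
        (fun x _ => (hd x).continuousAt.continuousWithinAt)
        (fun x _ => (hd x).hasDerivWithinAt) fun x hx => ?_
      linarith [hvlow x (interior_subset hx)]
    intro x hx
    have := hmono (left_mem_Icc.2 hab) hx hx.1
    simp only [sub_self, ne_eq, OfNat.ofNat_ne_zero, not_false_eq_true, zero_pow, mul_zero,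
      add_zero] at this
    linarith
  have hd : ∀ x, HasDerivAt (fun x => v x ^ 2 + (A - x ^ 2) * u x ^ 2 +
      u a ^ 2 * ((x ^ 2 - a ^ 2) - (x ^ 2 - a ^ 2) ^ 3 / 15))
      (2 * x * (u a ^ 2 * (1 - (x ^ 2 - a ^ 2) ^ 2 / 5) - u x ^ 2)) x := fun x => by
    have hy := ((hasDerivAt_id' x).fun_pow 2).sub_const (a ^ 2)
    refine HasDerivAt.congr_deriv
      ((((hv x).fun_pow 2).fun_add
        ((((hasDerivAt_id' x).fun_pow 2).const_sub A).fun_mul ((hu x).fun_pow 2))).add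
      ((hy.sub ((hy.pow 3).div_const 15)).const_mul (u a ^ 2))) ?_
    simp
    ring
  have hanti : AntitoneOn (fun x => v x ^ 2 + (A - x ^ 2) * u x ^ 2 +
      u a ^ 2 * ((x ^ 2 - a ^ 2) - (x ^ 2 - a ^ 2) ^ 3 / 15)) (Icc a b) := by
    refine antitoneOn_of_hasDerivWithinAt_nonpos (convex_Icc a b)
      (fun x _ => (hd x).continuousAt.continuousWithinAt)
      (fun x _ => (hd x).hasDerivWithinAt) fun x hx => ?_
    have hx' := interior_subset hx
    have hx0 : 0 ≤ x := ha.trans hx'.1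
    have hlow : u a ^ 2 * (1 - 4 / 3 * (x - a) ^ 2) ≤ u x ^ 2 := by
      nlinarith [sq_nonneg (u x - u a), mul_le_mul_of_nonneg_left (hulow x hx') hpos.le]
    have hs : 4 / 3 * (x - a) ^ 2 ≤ (x ^ 2 - a ^ 2) ^ 2 / 5 := by
      have h1 : 20 / 3 ≤ (x + a) ^ 2 := by nlinarith [hx'.1]
      nlinarith [mul_le_mul_of_nonneg_right h1 (sq_nonneg (x - a))]
    have hs' := mul_le_mul_of_nonneg_left hs (sq_nonneg (u a))
    exact mul_nonpos_of_nonneg_of_nonpos (by positivity) (by linarith)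
  have hfin := hanti (left_mem_Icc.2 hab) (right_mem_Icc.2 hab) hab
  have hEb := hE b (ha.trans hab)
  simp only [hva, hb2] at hfin hEb
  have hcube : (A + 1 / 2 - a ^ 2) ^ 3 ≤ (11 / 6) ^ 3 :=
    pow_le_pow_left₀ (by linarith) (by linarith) 3
  nlinarith [mul_le_mul_of_nonneg_left hcube (sq_nonneg (u a)), pow_pos hpos 2]

lemma sq_le_of_oscillator (hA : 3 ≤ A) (hu : ∀ x, HasDerivAt u (v x) x)
    (hv : ∀ x, HasDerivAt v (-(A - x ^ 2) * u x) x)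
    (hu0 : Tendsto u atTop (𝓝 0)) (hxu0 : Tendsto (fun x => x * u x) atTop (𝓝 0))
    (hv0 : Tendsto v atTop (𝓝 0)) {K : ℝ}
    (hK : √A * u 0 ^ 2 + v 0 ^ 2 / √A ≤ √(4 / 3) * K) {x : ℝ} (hx : 0 ≤ x) :
    u x ^ 2 ≤ K := by
  have hbound : ∀ y, 0 ≤ y → 4 / 3 ≤ A - y ^ 2 → u y ^ 2 ≤ K := fun y hy hyA => by
    have h := (sqrt_mul_sq_le_of_oscillator hu hv hy (by linarith)).trans hK
    have h2 := mul_le_mul_of_nonneg_right (Real.sqrt_le_sqrt hyA) (sq_nonneg (u y))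
    exact le_of_mul_le_mul_left (h2.trans h) (by positivity)
  rcases eq_or_ne (u x) 0 with hux | hux
  · rw [hux]
    simpa using (sq_nonneg (u 0)).trans (hbound 0 le_rfl (by linarith))
  have hcont : Continuous u := continuous_iff_continuousAt.2 fun y => (hu y).continuousAt
  obtain ⟨a, ha, hmax⟩ : ∃ a ∈ Ici (0 : ℝ), IsMaxOn (fun y => u y ^ 2) (Ici 0) a := by
    refine (hcont.pow 2).continuousOn.exists_isMaxOn' isClosed_Ici (x₀ := x) hx ?_
    have hev : ∀ᶠ y in atTop, u y ^ 2 ≤ u x ^ 2 :=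
      ((by simpa using hu0.pow 2 : Tendsto (fun y => u y ^ 2) atTop (𝓝 0)).eventually_lt_const
        (by positivity)).mono fun _ h => h.le
    obtain ⟨N, hN⟩ := eventually_atTop.1 hev
    rw [eventually_inf_principal]
    filter_upwards [(isCompact_Icc (a := 0) (b := N)).compl_mem_cocompact] with y hy hy0
    exact hN y (le_of_not_ge fun h => hy ⟨hy0, h⟩)
  have hle : ∀ y, 0 ≤ y → u y ^ 2 ≤ u a ^ 2 := fun y hy => hmax hy
  refine (hle x hx).trans (hbound a ha ?_)
  rcases (mem_Ici.1 ha).eq_or_lt with ha0 | ha0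
  · rw [← ha0]; linarith
  have hua : u a ≠ 0 := fun h => by
    have h1 := hle x hx
    have : 0 < u x ^ 2 := by positivity
    rw [h] at h1
    linarith
  have hva : v a = 0 := by
    have h := (hmax.isLocalMax (Ici_mem_nhds ha0)).hasDerivAt_eq_zero ((hu a).fun_pow 2)
    simpa [hua] using h
  have hE := fun y hy => oscillator_energy_nonneg hu hv hu0 hxu0 hv0 (x := y) hy
  have habs : ∀ y, 0 ≤ y → |u y| ≤ |u a| := fun y hy => sq_le_sq.1 (hle y hy)
  rcases hua.lt_or_gt with hneg | hpos
  · refine le_sub_sq_of_isMaxOn_oscillator (u := fun y => -u y) (v := fun y => -v y) hA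
      (fun y => (hu y).fun_neg) (fun y => ?_) (by simpa using hE) ha (by simpa using hva)
      (by simpa using hneg) (fun y hy => ?_)
    · exact (hv y).fun_neg.congr_deriv (by ring)
    · rw [abs_neg, ← abs_of_neg hneg]
      exact habs y hy
  · exact le_sub_sq_of_isMaxOn_oscillator hA hu hv hE ha hva hpos
      fun y hy => (habs y hy).trans_eq (abs_of_pos hpos)

end HarmonicOscillator

/-- The `k`-th derivative of `e^{-x²}`. -/
noncomputable def gaussDeriv (k : ℕ) : ℝ → ℝ :=
  iteratedDeriv k (fun y : ℝ => Real.exp (-y ^ 2))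

lemma gaussDeriv_zero (x : ℝ) : gaussDeriv 0 x = Real.exp (-x ^ 2) := by
  simp [gaussDeriv]

lemma hasDerivAt_gaussDeriv (k : ℕ) (x : ℝ) :
    HasDerivAt (gaussDeriv k) (gaussDeriv (k + 1) x) x := by
  have hs : ContDiff ℝ (k + 1) (fun y : ℝ => Real.exp (-y ^ 2)) := by fun_prop
  have hd := hs.differentiable_iteratedDeriv k (by exact_mod_cast Nat.lt_succ_self k)
  unfold gaussDeriv
  rw [iteratedDeriv_succ]
  exact (hd x).hasDerivAt

lemma gaussDeriv_one (x : ℝ) : gaussDeriv 1 x = -2 * x * gaussDeriv 0 x := by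
  refine (hasDerivAt_gaussDeriv 0 x).unique ?_
  rw [gaussDeriv_zero, funext gaussDeriv_zero]
  refine HasDerivAt.congr_deriv
    (((hasDerivAt_id' x).fun_pow 2).fun_neg.exp) ?_
  simp
  ring

lemma gaussDeriv_add_two (k : ℕ) (x : ℝ) :
    gaussDeriv (k + 2) x = -2 * x * gaussDeriv (k + 1) x - 2 * (k + 1) * gaussDeriv k x := by
  induction k generalizing x with
  | zero =>
    refine (hasDerivAt_gaussDeriv 1 x).unique ?_
    rw [funext gaussDeriv_one]
    refine HasDerivAt.congr_deriv
      (((hasDerivAt_id' x).const_mul (-2)).fun_mul (hasDerivAt_gaussDeriv 0 x)) ?_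
    simp [gaussDeriv_one]
    ring
  | succ k ih =>
    refine (hasDerivAt_gaussDeriv (k + 2) x).unique ?_
    rw [funext ih]
    refine HasDerivAt.congr_deriv
      ((((hasDerivAt_id' x).const_mul (-2)).fun_mul (hasDerivAt_gaussDeriv (k + 1) x)).sub
      ((hasDerivAt_gaussDeriv k x).const_mul (2 * ((k : ℝ) + 1)))) ?_
    simp only [ih]
    push_cast
    ring

lemma gaussDeriv_neg (k : ℕ) (x : ℝ) : gaussDeriv k (-x) = (-1) ^ k * gaussDeriv k x := by
  have h := iteratedDeriv_comp_neg k (fun y : ℝ => Real.exp (-y ^ 2)) (-x)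
  simpa [gaussDeriv] using h

lemma tendsto_pow_mul_exp_mul_gaussDeriv (k m : ℕ) :
    Tendsto (fun x : ℝ => x ^ m * (Real.exp (x ^ 2 / 2) * gaussDeriv k x)) atTop (𝓝 0) := by
  induction k using Nat.twoStepInduction generalizing m with
  | zero =>
    have h := (tendsto_rpow_abs_mul_exp_neg_mul_sq_cocompact (a := 1 / 2) (by norm_num)
      (m : ℝ)).mono_left atTop_le_cocompact
    refine h.congr' ?_
    filter_upwards [eventually_ge_atTop 0] with x hx
    rw [gaussDeriv_zero, ← Real.exp_add, abs_of_nonneg hx, Real.rpow_natCast]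
    ring_nf
  | one =>
    have h := (tendsto_rpow_abs_mul_exp_neg_mul_sq_cocompact (a := 1 / 2) (by norm_num)
      ((m + 1 : ℕ) : ℝ)).mono_left atTop_le_cocompact |>.const_mul (-2)
    rw [mul_zero] at h
    refine h.congr' ?_
    filter_upwards [eventually_ge_atTop 0] with x hx
    have he : Real.exp (x ^ 2 / 2) * Real.exp (-x ^ 2) = Real.exp (-(1 / 2) * x ^ 2) := by
      rw [← Real.exp_add]; ring_nf
    rw [gaussDeriv_one, gaussDeriv_zero, ← he, abs_of_nonneg hx, Real.rpow_natCast]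
    ring
  | more k ih0 ih1 =>
    have h := ((ih1 (m + 1)).const_mul (-2)).sub ((ih0 m).const_mul (2 * ((k : ℝ) + 1)))
    simp only [mul_zero, sub_zero] at h
    refine h.congr fun x => ?_
    rw [gaussDeriv_add_two]
    ring

lemma gaussDeriv_two_mul_add_one_zero (m : ℕ) : gaussDeriv (2 * m + 1) 0 = 0 := by
  induction m with
  | zero => simp [gaussDeriv_one]
  | succ m ih =>
    rw [show 2 * (m + 1) + 1 = (2 * m + 1) + 2 by ring, gaussDeriv_add_two, ih]
    simp

lemma gaussDeriv_two_mul_zero_le (m : ℕ) :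
    (3 * m + 1) * (gaussDeriv (2 * m) 0 ^ 2) ^ 2 ≤
      ((2 : ℝ) ^ (2 * m) * (Nat.factorial (2 * m))) ^ 2 := by
  induction m with
  | zero => simp [gaussDeriv_zero]
  | succ m ih =>
    rw [show 2 * (m + 1) = 2 * m + 2 by ring, gaussDeriv_add_two, Nat.factorial_succ,
      Nat.factorial_succ]
    push_cast
    set g := gaussDeriv (2 * m) 0
    set c := (2 : ℝ) ^ (2 * m) * (Nat.factorial (2 * m))
    have hm : (0 : ℝ) ≤ m := m.cast_nonneg
    have h1 : (3 * (m : ℝ) + 1 + 3) * (2 * m + 1) ^ 2 ≤ (2 * m + 2) ^ 2 * (3 * m + 1) := by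
      nlinarith
    calc _ = (16 * (2 * (m : ℝ) + 1) ^ 2 * (g ^ 2) ^ 2) *
            ((3 * (m : ℝ) + 1 + 3) * (2 * m + 1) ^ 2) := by ring
      _ ≤ (16 * (2 * (m : ℝ) + 1) ^ 2 * (g ^ 2) ^ 2) * ((2 * m + 2) ^ 2 * (3 * m + 1)) := by
          gcongr
      _ = 16 * (2 * (m : ℝ) + 1) ^ 2 * (2 * m + 2) ^ 2 * ((3 * m + 1) * (g ^ 2) ^ 2) := by ring
      _ ≤ 16 * (2 * (m : ℝ) + 1) ^ 2 * (2 * m + 2) ^ 2 * c ^ 2 := by gcongr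
      _ = _ := by simp only [c]; ring

lemma gaussDeriv_initial_le (k : ℕ) :
    √(2 * k + 1) * gaussDeriv k 0 ^ 2 + gaussDeriv (k + 1) 0 ^ 2 / √(2 * k + 1) ≤
      √(4 / 3) * ((2 : ℝ) ^ k * (Nat.factorial k)) := by
  have hsq : √(4 / 3 : ℝ) ^ 2 = 4 / 3 := Real.sq_sqrt (by norm_num)
  have hA : √(2 * k + 1 : ℝ) ^ 2 = 2 * k + 1 := Real.sq_sqrt (by positivity)
  refine le_of_sq_le_sq ?_ (by positivity)
  rw [mul_pow, hsq]
  obtain ⟨m, rfl | rfl⟩ := k.even_or_odd'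
  · have h := gaussDeriv_two_mul_zero_le m
    rw [gaussDeriv_two_mul_add_one_zero]
    simp only [ne_eq, OfNat.ofNat_ne_zero, not_false_eq_true, zero_pow, zero_div, add_zero]
    rw [mul_pow, hA]
    push_cast
    nlinarith [sq_nonneg (gaussDeriv (2 * m) 0 ^ 2)]
  · have h := gaussDeriv_two_mul_zero_le m
    have hm : (0 : ℝ) ≤ m := m.cast_nonneg
    rw [gaussDeriv_two_mul_add_one_zero, gaussDeriv_add_two, Nat.factorial_succ]
    simp only [ne_eq, OfNat.ofNat_ne_zero, not_false_eq_true, zero_pow, mul_zero, zero_add]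
    rw [div_pow, hA, div_le_iff₀ (by positivity)]
    push_cast
    set g := gaussDeriv (2 * m) 0
    set c := (2 : ℝ) ^ (2 * m) * (Nat.factorial (2 * m)) with hc
    have h1 : 3 * (2 * (m : ℝ) + 1) ^ 2 ≤ (4 * m + 3) * (3 * m + 1) := by nlinarith
    calc _ = 16 / 3 * (2 * (m : ℝ) + 1) ^ 2 * (g ^ 2) ^ 2 * (3 * (2 * (m : ℝ) + 1) ^ 2) := by ring
      _ ≤ 16 / 3 * (2 * (m : ℝ) + 1) ^ 2 * (g ^ 2) ^ 2 * ((4 * m + 3) * (3 * m + 1)) := by gcongr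
      _ = 16 / 3 * (2 * (m : ℝ) + 1) ^ 2 * (4 * m + 3) * ((3 * m + 1) * (g ^ 2) ^ 2) := by ring
      _ ≤ 16 / 3 * (2 * (m : ℝ) + 1) ^ 2 * (4 * m + 3) * c ^ 2 := by gcongr
      _ = _ := by rw [hc, pow_succ]; ring

lemma hasDerivAt_exp_sq_half (x : ℝ) :
    HasDerivAt (fun x : ℝ => Real.exp (x ^ 2 / 2)) (x * Real.exp (x ^ 2 / 2)) x := by
  refine HasDerivAt.congr_deriv
    ((((hasDerivAt_id' x).fun_pow 2).div_const 2).exp) ?_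
  simp
  ring

lemma exp_mul_gaussDeriv_sq_le_of_nonneg (k : ℕ) {x : ℝ} (hx : 0 ≤ x) :
    (Real.exp (x ^ 2 / 2) * gaussDeriv k x) ^ 2 ≤ (2 : ℝ) ^ k * (Nat.factorial k) := by
  rcases k.eq_zero_or_pos with rfl | hk
  · rw [gaussDeriv_zero, ← Real.exp_add, ← Real.exp_nat_mul]
    simp only [pow_zero, Nat.factorial_zero, Nat.cast_one, mul_one, Real.exp_le_one_iff]
    push_cast
    nlinarith [sq_nonneg x]
  have hk' : (1 : ℝ) ≤ k := by exact_mod_cast hk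
  have h0 := tendsto_pow_mul_exp_mul_gaussDeriv k 0
  have h1 := tendsto_pow_mul_exp_mul_gaussDeriv k 1
  have h2 := tendsto_pow_mul_exp_mul_gaussDeriv (k + 1) 0
  simp only [pow_zero, one_mul, pow_one] at h0 h1 h2
  refine sq_le_of_oscillator (A := 2 * k + 1)
    (u := fun x => Real.exp (x ^ 2 / 2) * gaussDeriv k x)
    (v := fun x => x * (Real.exp (x ^ 2 / 2) * gaussDeriv k x) +
      Real.exp (x ^ 2 / 2) * gaussDeriv (k + 1) x)
    (by linarith) (fun y => ?_) (fun y => ?_) h0 h1 (by simpa using h1.add h2) ?_ hx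
  · refine HasDerivAt.congr_deriv
      ((hasDerivAt_exp_sq_half y).fun_mul (hasDerivAt_gaussDeriv k y)) ?_
    ring
  · have hu := (hasDerivAt_exp_sq_half y).fun_mul (hasDerivAt_gaussDeriv k y)
    refine HasDerivAt.congr_deriv
      (((hasDerivAt_id' y).fun_mul hu).add
      ((hasDerivAt_exp_sq_half y).fun_mul (hasDerivAt_gaussDeriv (k + 1) y))) ?_
    simp [gaussDeriv_add_two]
    ring
  · simpa using gaussDeriv_initial_le k

lemma exp_mul_gaussDeriv_sq_le (k : ℕ) (x : ℝ) :
    (Real.exp (x ^ 2 / 2) * gaussDeriv k x) ^ 2 ≤ (2 : ℝ) ^ k * (Nat.factorial k) := by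
  rcases le_total 0 x with hx | hx
  · exact exp_mul_gaussDeriv_sq_le_of_nonneg k hx
  · have h := exp_mul_gaussDeriv_sq_le_of_nonneg k (neg_nonneg.2 hx)
    rw [gaussDeriv_neg, neg_sq, mul_left_comm, mul_pow, ← pow_mul, mul_comm k 2, pow_mul] at h
    simpa using h

theorem hermiteFun_abs_le (k : ℕ) (x : ℝ) :
    |hermiteFun k x| ≤ π ^ (-(1 / 4) : ℝ) := by
  have hf : hermiteFun k x = (-1) ^ k * ((√(2 ^ k * (Nat.factorial k) * √π))⁻¹ *
      (Real.exp (x ^ 2 / 2) * gaussDeriv k x)) := by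
    have he : Real.exp (x ^ 2 / 2) = Real.exp (x ^ 2) * Real.exp (-x ^ 2 / 2) := by
      rw [← Real.exp_add]; ring_nf
    rw [he, hermiteFun, hermitePoly, gaussDeriv]
    ring
  have hπ : π ^ (-(1 / 4) : ℝ) = (√√π)⁻¹ := by
    rw [Real.rpow_neg pi_pos.le, Real.sqrt_eq_rpow, Real.sqrt_eq_rpow, ← Real.rpow_mul pi_pos.le]
    norm_num
  have hc : 0 < √((2 : ℝ) ^ k * (Nat.factorial k)) := by positivity
  have hs : 0 < √√π := by positivity
  rw [hf, hπ, abs_mul, abs_pow, abs_neg, abs_one, one_pow, one_mul, abs_mul,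
    abs_of_nonneg (by positivity), Real.sqrt_mul (by positivity), mul_inv, mul_comm (√_)⁻¹,
    mul_assoc]
  refine mul_le_of_le_one_right (by positivity) ?_
  rw [inv_mul_le_one₀ hc]
  exact Real.abs_le_sqrt (exp_mul_gaussDeriv_sq_le k x)
end

section
/- For every natural number k and every real number x, the function h̄_k(x) = 1/2 + (π^{1/4}/2) h_k(x) satisfies 0 ≤ h̄_k(x) ≤ 1. -/
open Real MeasureTheory

/-- The shifted Hermite function `h̄_k(x) = 1/2 + (π^{1/4}/2) h_k(x)`. -/
noncomputable def hermiteFunBar (k : ℕ) (x : ℝ) : ℝ :=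
  1 / 2 + π ^ ((1 : ℝ) / 4) / 2 * hermiteFun k x

/-- The physicists' Hermite polynomials, given by their three-term recurrence. -/
noncomputable def hermiteRec : ℕ → ℝ → ℝ
  | 0, _ => 1
  | 1, x => 2 * x
  | n + 2, x => 2 * x * hermiteRec (n + 1) x - 2 * (n + 1) * hermiteRec n x

theorem hermiteRec_add_two (n : ℕ) (x : ℝ) :
    hermiteRec (n + 2) x = 2 * x * hermiteRec (n + 1) x - 2 * (n + 1) * hermiteRec n x := by
  rw [hermiteRec]

theorem hasDerivAt_hermiteRec_succ (n : ℕ) (x : ℝ) :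
    HasDerivAt (hermiteRec (n + 1)) (2 * (n + 1) * hermiteRec n x) x := by
  induction n using Nat.twoStepInduction with
  | zero =>
    have h : hermiteRec (0 + 1) = fun y => 2 * y := by funext y; simp [hermiteRec]
    rw [h]
    simpa [hermiteRec] using (hasDerivAt_id x).const_mul 2
  | one =>
    have h : hermiteRec (1 + 1) = fun y => 4 * y ^ 2 - 2 := by
      funext y; simp [hermiteRec]; ring
    rw [h]
    refine HasDerivAt.congr_deriv (((hasDerivAt_pow 2 x).const_mul 4).sub_const 2) ?_
    simp only [hermiteRec]; push_cast; ring
  | more n h0 h1 =>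
    have h : hermiteRec (n + 2 + 1) = fun y =>
        2 * y * hermiteRec (n + 2) y - 2 * ((n + 1 : ℕ) + 1) * hermiteRec (n + 1) y := by
      funext y; exact hermiteRec_add_two (n + 1) y
    rw [h]
    refine HasDerivAt.congr_deriv ((((hasDerivAt_id x).const_mul 2).mul h1).sub
      (h0.const_mul (2 * (((n + 1 : ℕ) : ℝ) + 1)))) ?_
    rw [hermiteRec_add_two]
    push_cast
    simp only [id]
    ring

theorem hasDerivAt_hermiteRec (n : ℕ) (x : ℝ) :
    HasDerivAt (hermiteRec n) (2 * x * hermiteRec n x - hermiteRec (n + 1) x) x := by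
  cases n with
  | zero =>
    have h : hermiteRec 0 = fun _ => 1 := by funext y; simp [hermiteRec]
    have h' : 2 * x * hermiteRec 0 x - hermiteRec (0 + 1) x = 0 := by simp [hermiteRec]
    rw [h', h]
    exact hasDerivAt_const x 1
  | succ n =>
    refine HasDerivAt.congr_deriv (hasDerivAt_hermiteRec_succ n x) ?_
    rw [hermiteRec_add_two]
    ring

theorem hermiteRec_neg (n : ℕ) (x : ℝ) : hermiteRec n (-x) = (-1) ^ n * hermiteRec n x := by
  induction n using Nat.twoStepInduction with
  | zero => simp [hermiteRec]
  | one => simp [hermiteRec]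
  | more n h0 h1 =>
    rw [hermiteRec_add_two, hermiteRec_add_two, h0, h1]
    ring

theorem iteratedDeriv_exp_neg_sq (k : ℕ) :
    iteratedDeriv k (fun y : ℝ => Real.exp (-y ^ 2)) =
      fun x => (-1) ^ k * hermiteRec k x * Real.exp (-x ^ 2) := by
  induction k with
  | zero => funext x; simp [hermiteRec]
  | succ k ih =>
    rw [iteratedDeriv_succ, ih]
    funext x
    have he : HasDerivAt (fun y : ℝ => Real.exp (-y ^ 2)) (Real.exp (-x ^ 2) * -(2 * x)) x := by
      simpa using (hasDerivAt_pow 2 x).neg.exp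
    exact ((((hasDerivAt_hermiteRec k x).const_mul ((-1) ^ k)).mul he).congr_deriv (by ring)).deriv

theorem hermitePoly_eq_hermiteRec (k : ℕ) (x : ℝ) : hermitePoly k x = hermiteRec k x := by
  have hs : (-1 : ℝ) ^ k * (-1) ^ k = 1 := by rw [← mul_pow]; simp
  have he : Real.exp (x ^ 2) * Real.exp (-x ^ 2) = 1 := by rw [← Real.exp_add]; simp
  rw [hermitePoly, iteratedDeriv_exp_neg_sq]
  linear_combination hermiteRec k x * Real.exp (x ^ 2) * Real.exp (-x ^ 2) * hs +
    hermiteRec k x * he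

/-- Beyond `√(2n)` the ratio `H_{n+1} / H_n` dominates the larger root of `t² - 2xt + 2n`. -/
theorem hermiteRec_ratio_lower_bound {x : ℝ} (hx : 0 < x) (n : ℕ) (hn : 2 * n ≤ x ^ 2) :
    0 < hermiteRec n x ∧ (x + √(x ^ 2 - 2 * n)) * hermiteRec n x ≤ hermiteRec (n + 1) x := by
  induction n with
  | zero =>
    refine ⟨by simp [hermiteRec], ?_⟩
    simp [hermiteRec, Real.sqrt_sq hx.le]
    linarith
  | succ n ih =>
    push_cast at hn ⊢
    obtain ⟨hpos, hle⟩ := ih (by linarith)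
    set s := √(x ^ 2 - 2 * (n + 1)) with hs
    have hs0 : 0 ≤ s := Real.sqrt_nonneg _
    have hsq : s ^ 2 = x ^ 2 - 2 * (n + 1) := Real.sq_sqrt (by linarith)
    have hmono : s ≤ √(x ^ 2 - 2 * n) := Real.sqrt_le_sqrt (by linarith)
    have hle' : (x + s) * hermiteRec n x ≤ hermiteRec (n + 1) x := by
      refine le_trans ?_ hle
      gcongr
    have hsx : s ≤ x := by
      refine abs_le_of_sq_le_sq' ?_ hx.le |>.2
      have : (0 : ℝ) ≤ n := n.cast_nonneg
      linarith
    refine ⟨lt_of_lt_of_le (by positivity) hle', ?_⟩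
    rw [hermiteRec_add_two]
    have := mul_le_mul_of_nonneg_left hle' (sub_nonneg.2 hsx)
    have h2 : (x - s) * ((x + s) * hermiteRec n x) = 2 * (n + 1) * hermiteRec n x := by
      linear_combination (-hermiteRec n x) * hsq
    linarith

theorem hermiteRec_zero_pow_four_le (n : ℕ) :
    (n + 1) * hermiteRec n 0 ^ 4 ≤ ((2 : ℝ) ^ n * n.factorial) ^ 2 := by
  induction n using Nat.twoStepInduction with
  | zero => simp [hermiteRec]
  | one => simp [hermiteRec]
  | more n h0 _ =>
    rw [hermiteRec_add_two, Nat.factorial_succ, Nat.factorial_succ]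
    push_cast
    have hn : (0 : ℝ) ≤ n := n.cast_nonneg
    calc ((n : ℝ) + 2 + 1) * (2 * 0 * hermiteRec (n + 1) 0 - 2 * (n + 1) * hermiteRec n 0) ^ 4
        = 16 * (n + 1) ^ 3 * ((n + 3) * (n + 1)) * hermiteRec n 0 ^ 4 := by ring
      _ ≤ 16 * (n + 1) ^ 3 * (n + 2) ^ 2 * hermiteRec n 0 ^ 4 := by gcongr; nlinarith
      _ = 16 * (n + 1) ^ 2 * (n + 2) ^ 2 * ((n + 1) * hermiteRec n 0 ^ 4) := by ring
      _ ≤ 16 * (n + 1) ^ 2 * (n + 2) ^ 2 * ((2 : ℝ) ^ n * n.factorial) ^ 2 := by gcongr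
      _ = _ := by ring

theorem hermiteRec_zero_mul_succ (n : ℕ) : hermiteRec n 0 * hermiteRec (n + 1) 0 = 0 := by
  induction n with
  | zero => simp [hermiteRec]
  | succ n ih =>
    rw [hermiteRec_add_two]
    linear_combination (-2 * ((n : ℝ) + 1)) * ih

theorem hasDerivAt_exp_neg_sq_div_two (x : ℝ) :
    HasDerivAt (fun y : ℝ => Real.exp (-y ^ 2 / 2)) (Real.exp (-x ^ 2 / 2) * -x) x := by
  have h : HasDerivAt (fun y : ℝ => -y ^ 2 / 2) (-x) x :=
    ((hasDerivAt_pow 2 x).neg.div_const 2).congr_deriv (by push_cast; ring)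
  exact h.exp

/-- A Liouville–Green energy for solutions of the Weber equation decreases on `[0, a]` if `a² < l`. -/
theorem liouvilleGreen_energy_antitoneOn {l a : ℝ} (ha : a ^ 2 < l) {f g : ℝ → ℝ}
    (hf : ∀ x, HasDerivAt f (g x) x) (hg : ∀ x, HasDerivAt g ((x ^ 2 - l) * f x) x) :
    AntitoneOn (fun x => (l - x ^ 2) * (f x ^ 2 + (2 * (l - x ^ 2) * g x - x * f x) ^ 2 /
      (4 * (l - x ^ 2) ^ 3 + 5 * x ^ 2 + 2 * (l - x ^ 2))) ^ 2) (Set.Icc 0 a) := by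
  have key : ∀ x ∈ Set.Icc 0 a, ∃ d ≤ 0, HasDerivAt
      (fun x => (l - x ^ 2) * (f x ^ 2 + (2 * (l - x ^ 2) * g x - x * f x) ^ 2 /
        (4 * (l - x ^ 2) ^ 3 + 5 * x ^ 2 + 2 * (l - x ^ 2))) ^ 2) d x := by
    intro x hx
    have hQ : 0 < l - x ^ 2 := by nlinarith [hx.1, hx.2]
    have hD : 0 < 4 * (l - x ^ 2) ^ 3 + 5 * x ^ 2 + 2 * (l - x ^ 2) := by positivity
    have dQ : HasDerivAt (fun x => l - x ^ 2) (-(2 * x)) x := by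
      simpa using (hasDerivAt_pow 2 x).const_sub l
    have dD : HasDerivAt (fun x => 4 * (l - x ^ 2) ^ 3 + 5 * x ^ 2 + 2 * (l - x ^ 2))
        (-24 * x * (l - x ^ 2) ^ 2 + 6 * x) x := by
      refine HasDerivAt.congr_deriv ((((dQ.pow 3).const_mul 4).add
        ((hasDerivAt_pow 2 x).const_mul 5)).add
        (dQ.const_mul 2)) ?_
      push_cast; ring
    have dP : HasDerivAt (fun x => 2 * (l - x ^ 2) * g x - x * f x)
        (-5 * x * g x - (2 * (l - x ^ 2) ^ 2 + 1) * f x) x := by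
      refine HasDerivAt.congr_deriv (((dQ.const_mul 2).mul (hg x)).sub
        ((hasDerivAt_id x).mul (hf x))) ?_
      simp only [id]; ring
    have dE := dQ.mul ((((hf x).pow 2).add ((dP.pow 2).div dD hD.ne')).pow 2)
    set P := 2 * (l - x ^ 2) * g x - x * f x with hP
    set D := 4 * (l - x ^ 2) ^ 3 + 5 * x ^ 2 + 2 * (l - x ^ 2) with hDdef
    refine ⟨-2 * (f x ^ 2 + P ^ 2 / D) * (x * P ^ 2 / D ^ 2 * (30 * x ^ 2 + 18 * (l - x ^ 2))),
      ?_, ?_⟩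
    · have : 0 ≤ (f x ^ 2 + P ^ 2 / D) *
          (x * P ^ 2 / D ^ 2 * (30 * x ^ 2 + 18 * (l - x ^ 2))) := by
        have := hx.1
        positivity
      linarith
    · refine HasDerivAt.congr_deriv dE ?_
      simp only [Pi.add_apply, Pi.pow_apply, Pi.div_apply]
      rw [← hP, ← hDdef]
      have hW : -(x * P ^ 2 / D ^ 2 * (30 * x ^ 2 + 18 * (l - x ^ 2))) =
          -x * (f x ^ 2 + P ^ 2 / D) + (l - x ^ 2) * (2 * f x * g x +
            (2 * P * (-5 * x * g x - (2 * (l - x ^ 2) ^ 2 + 1) * f x) * D -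
              P ^ 2 * (-24 * x * (l - x ^ 2) ^ 2 + 6 * x)) / D ^ 2) := by
        have hD0 := hD.ne'
        field_simp
        rw [hP, hDdef]
        ring
      clear_value P D
      simp only [Nat.cast_ofNat, Nat.add_one_sub_one, pow_one]
      linear_combination (-2 * (f x ^ 2 + P ^ 2 / D)) * hW
  apply antitoneOn_of_deriv_nonpos (convex_Icc 0 a)
  · intro x hx
    obtain ⟨d, -, hd⟩ := key x hx
    exact hd.continuousAt.continuousWithinAt
  · intro x hx
    obtain ⟨d, -, hd⟩ := key x (interior_subset hx)
    exact hd.differentiableAt.differentiableWithinAt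
  · intro x hx
    obtain ⟨d, hd0, hd⟩ := key x (interior_subset hx)
    rwa [hd.deriv]

theorem hasDerivAt_hermiteRec_succ_mul_exp (m : ℕ) (x : ℝ) :
    HasDerivAt (fun x => hermiteRec (m + 1) x * Real.exp (-x ^ 2 / 2))
      ((2 * (m + 1) * hermiteRec m x - x * hermiteRec (m + 1) x) * Real.exp (-x ^ 2 / 2)) x := by
  refine HasDerivAt.congr_deriv ((hasDerivAt_hermiteRec_succ m x).mul
    (hasDerivAt_exp_neg_sq_div_two x)) ?_
  ring

/-- The bound on the oscillatory region, where the energy at `0` controls everything. -/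
theorem hermiteRec_succ_mul_exp_sq_le_of_sq_le {m : ℕ} {x : ℝ} (hx : 0 ≤ x)
    (hxm : x ^ 2 ≤ 2 * m + 1) :
    (hermiteRec (m + 1) x * Real.exp (-x ^ 2 / 2)) ^ 2 ≤ 2 ^ (m + 1) * (m + 1).factorial := by
  have hm : (0 : ℝ) ≤ m := m.cast_nonneg
  have hg : ∀ y, HasDerivAt (fun x => (2 * (m + 1) * hermiteRec m x - x * hermiteRec (m + 1) x) *
      Real.exp (-x ^ 2 / 2))
      ((y ^ 2 - (2 * m + 3)) * (hermiteRec (m + 1) y * Real.exp (-y ^ 2 / 2))) y := by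
    intro y
    refine HasDerivAt.congr_deriv
      ((((hasDerivAt_hermiteRec m y).const_mul (2 * ((m : ℝ) + 1))).sub
      ((hasDerivAt_id y).mul (hasDerivAt_hermiteRec_succ m y))).mul
      (hasDerivAt_exp_neg_sq_div_two y)) ?_
    simp only [id, Pi.sub_apply, Pi.mul_apply]
    ring
  have hE := liouvilleGreen_energy_antitoneOn (l := 2 * m + 3) (a := x) (by linarith)
    (hasDerivAt_hermiteRec_succ_mul_exp m) hg (Set.left_mem_Icc.2 hx) (Set.right_mem_Icc.2 hx) hx
  dsimp only at hE
  set F := hermiteRec (m + 1) x * Real.exp (-x ^ 2 / 2)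
  set N : ℝ := 2 ^ (m + 1) * (m + 1).factorial with hN
  have hlow : 2 * (F ^ 2) ^ 2 ≤ 2 * N ^ 2 := by
    have hQ : 2 ≤ 2 * (m : ℝ) + 3 - x ^ 2 := by linarith
    have hQ0 : 0 < 2 * (m : ℝ) + 3 - x ^ 2 := by linarith
    refine le_trans ?_ (hE.trans ?_)
    · gcongr
      exact le_add_of_nonneg_right (by positivity)
    · have h4 := hermiteRec_zero_pow_four_le m
      have h4' := hermiteRec_zero_pow_four_le (m + 1)
      rw [← hN] at h4'
      have hNm : N = 2 * (m + 1) * (2 ^ m * m.factorial) := by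
        rw [hN, Nat.factorial_succ]; push_cast; ring
      push_cast at h4'
      simp only [ne_eq, OfNat.ofNat_ne_zero, not_false_eq_true, zero_pow, neg_zero, zero_div,
        Real.exp_zero, mul_one, zero_mul, sub_zero, mul_zero, add_zero]
      rcases mul_eq_zero.1 (hermiteRec_zero_mul_succ m) with h | h
      · rw [h]
        simp only [mul_zero, zero_pow, ne_eq, OfNat.ofNat_ne_zero, not_false_eq_true, zero_div,
          add_zero]
        nlinarith [pow_nonneg (sq_nonneg (hermiteRec (m + 1) 0)) 2]
      · rw [h]
        simp only [zero_pow, ne_eq, OfNat.ofNat_ne_zero, not_false_eq_true, zero_add]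
        set l : ℝ := 2 * m + 3 with hl
        have hl0 : 0 < l := by positivity
        set A := hermiteRec m 0
        calc l * ((2 * l * (2 * (m + 1) * A)) ^ 2 / (4 * l ^ 3 + 2 * l)) ^ 2
            ≤ l * ((2 * l * (2 * (m + 1) * A)) ^ 2 / (4 * l ^ 3)) ^ 2 := by
              gcongr
              linarith
          _ = 16 * (m + 1) ^ 3 / l * ((m + 1) * A ^ 4) := by field_simp; ring
          _ ≤ 16 * (m + 1) ^ 3 / l * ((2 : ℝ) ^ m * m.factorial) ^ 2 := by gcongr
          _ = 4 * (m + 1) / l * N ^ 2 := by rw [hNm]; field_simp; ring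
          _ ≤ 2 * N ^ 2 := by
              gcongr
              rw [div_le_iff₀ hl0]
              linarith
  exact abs_le_of_sq_le_sq' (by linarith) (by positivity) |>.2

theorem hermiteRec_mul_exp_sq_le_of_nonneg (n : ℕ) {x : ℝ} (hx : 0 ≤ x) :
    (hermiteRec n x * Real.exp (-x ^ 2 / 2)) ^ 2 ≤ 2 ^ n * n.factorial := by
  cases n with
  | zero =>
    have h : Real.exp (-x ^ 2 / 2) ≤ 1 := Real.exp_le_one_iff.2 (by nlinarith)
    simpa [hermiteRec] using pow_le_one₀ (n := 2) (Real.exp_pos _).le h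
  | succ m =>
    have hm : (0 : ℝ) ≤ m := m.cast_nonneg
    rcases le_total (x ^ 2) (2 * m + 1) with h | h
    · exact hermiteRec_succ_mul_exp_sq_le_of_sq_le hx h
    set a := √(2 * (m : ℝ) + 1) with ha
    have ha2 : a ^ 2 = 2 * m + 1 := Real.sq_sqrt (by positivity)
    have ha1 : 1 ≤ a := Real.one_le_sqrt.2 (by linarith)
    have hax : a ≤ x := (Real.sqrt_le_left hx).2 h
    have hanti : AntitoneOn (fun x => hermiteRec (m + 1) x * Real.exp (-x ^ 2 / 2))
        (Set.Ici a) := by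
      apply antitoneOn_of_deriv_nonpos (convex_Ici a)
      · exact fun y _ =>
          (hasDerivAt_hermiteRec_succ_mul_exp m y).continuousAt.continuousWithinAt
      · exact fun y _ =>
          (hasDerivAt_hermiteRec_succ_mul_exp m y).differentiableAt.differentiableWithinAt
      · intro y hy
        have hy : a ≤ y := interior_subset hy
        have hy2 : 2 * (m : ℝ) + 1 ≤ y ^ 2 := by nlinarith
        obtain ⟨hpos, hle⟩ :=
          hermiteRec_ratio_lower_bound (x := y) (by linarith) m (by linarith)
        have hs : 1 ≤ √(y ^ 2 - 2 * m) := Real.one_le_sqrt.2 (by linarith)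
        rw [(hasDerivAt_hermiteRec_succ_mul_exp m y).deriv]
        refine mul_nonpos_of_nonpos_of_nonneg (sub_nonpos.2 ?_) (Real.exp_pos _).le
        calc 2 * ((m : ℝ) + 1) * hermiteRec m y ≤ y * (y + 1) * hermiteRec m y := by
              refine mul_le_mul_of_nonneg_right ?_ hpos.le
              nlinarith
          _ = y * ((y + 1) * hermiteRec m y) := by ring
          _ ≤ y * ((y + √(y ^ 2 - 2 * m)) * hermiteRec m y) := by gcongr; linarith
          _ ≤ y * hermiteRec (m + 1) y := by gcongr; linarith
    have hxpos : 0 < x := by linarith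
    obtain ⟨hpos, hle⟩ := hermiteRec_ratio_lower_bound hxpos m (by linarith)
    have h0 : 0 ≤ hermiteRec (m + 1) x := le_trans (by positivity) hle
    calc (hermiteRec (m + 1) x * Real.exp (-x ^ 2 / 2)) ^ 2
        ≤ (hermiteRec (m + 1) a * Real.exp (-a ^ 2 / 2)) ^ 2 :=
          pow_le_pow_left₀ (by positivity) (hanti Set.self_mem_Ici hax hax) 2
      _ ≤ _ := hermiteRec_succ_mul_exp_sq_le_of_sq_le (by linarith) ha2.le

/-- Cramér's inequality for Hermite polynomials with Indritz's sharp constant. -/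
theorem hermiteRec_mul_exp_sq_le (n : ℕ) (x : ℝ) :
    (hermiteRec n x * Real.exp (-x ^ 2 / 2)) ^ 2 ≤ 2 ^ n * n.factorial := by
  rcases le_total 0 x with hx | hx
  · exact hermiteRec_mul_exp_sq_le_of_nonneg n hx
  · have h := hermiteRec_mul_exp_sq_le_of_nonneg n (neg_nonneg.2 hx)
    have hs : ((-1 : ℝ) ^ n) ^ 2 = 1 := by rw [← pow_mul, mul_comm, pow_mul]; simp
    rwa [hermiteRec_neg, neg_sq, mul_assoc, mul_pow, hs, one_mul] at h

theorem abs_hermiteFun_le (k : ℕ) (x : ℝ) : |π ^ ((1 : ℝ) / 4) * hermiteFun k x| ≤ 1 := by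
  have hN : (0 : ℝ) < 2 ^ k * k.factorial := by positivity
  have hroot : √(√π) = π ^ ((1 : ℝ) / 4) := by
    rw [Real.sqrt_eq_rpow, Real.sqrt_eq_rpow, ← Real.rpow_mul Real.pi_pos.le]
    norm_num
  have heq : π ^ ((1 : ℝ) / 4) * hermiteFun k x =
      hermiteRec k x * Real.exp (-x ^ 2 / 2) / √(2 ^ k * k.factorial) := by
    have := Real.sqrt_pos.2 hN
    rw [hermiteFun, hermitePoly_eq_hermiteRec, Real.sqrt_mul hN.le, hroot]
    field_simp
  rw [heq, abs_div, abs_of_nonneg (Real.sqrt_nonneg _), div_le_one (Real.sqrt_pos.2 hN)]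
  exact Real.abs_le_sqrt (hermiteRec_mul_exp_sq_le k x)

theorem hermiteFunBar_mem_Icc (k : ℕ) (x : ℝ) :
    hermiteFunBar k x ∈ Set.Icc (0 : ℝ) 1 := by
  obtain ⟨h1, h2⟩ := abs_le.1 (abs_hermiteFun_le k x)
  rw [hermiteFunBar, Set.mem_Icc]
  constructor <;> linarith
end
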